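/- arXiv:2309.07793 — 3 statements merged into one kernel-verified Lean document; each statement's English description precedes it below -/
import Mathlib

section
/- Fix an integer m ≥ 2 and a point x ∈ C_m all of whose coordinates are positive. If the presentation lattice L(x) is saturated, i.e., L(x) = span_ℚ(L(x)) ∩ ℤ^{A(x)} (in particular, if L(x) is the trivial subgroup), then there exists an Apéry point y of C_m with E(y) = E(x). -/
open scoped BigOperators

/-- The Kunz cone `C_m`: points indexed by residues modulo `m` (the coordinate at `0` is
ignored) satisfying `x i + x j ≥ x (i+j)` for nonzero `i, j` with `i + j ≠ 0`. -/
def KunzCone (m : ℕ) : Set (ZMod m → ℝ) :=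
  {x | ∀ i j : ZMod m, i ≠ 0 → j ≠ 0 → i + j ≠ 0 → x (i + j) ≤ x i + x j}

/-- The equality set `E(x)` of a point of the Kunz cone. -/
def EqualitySet (m : ℕ) (x : ZMod m → ℝ) : Set (ZMod m × ZMod m) :=
  {p | p.1 ≠ 0 ∧ p.2 ≠ 0 ∧ p.1 + p.2 ≠ 0 ∧ x p.1 + x p.2 = x (p.1 + p.2)}

/-- An Apéry point of `C_m`: a point of the cone with integer coordinates with
`y i ≡ i (mod m)` for every nonzero `i`. -/
def IsAperyPoint (m : ℕ) (y : ZMod m → ℝ) : Prop :=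
  y ∈ KunzCone m ∧ ∀ i : ZMod m, i ≠ 0 → ∃ z : ℤ, y i = (z : ℝ) ∧ (z : ZMod m) = i

/-- The atoms `A(x)` of a point of the Kunz cone with positive coordinates. -/
def KunzAtoms (m : ℕ) (x : ZMod m → ℝ) : Set (ZMod m) :=
  {a | a ≠ 0 ∧ ∀ i j : ZMod m, i ≠ 0 → j ≠ 0 → i + j = a → x i + x j ≠ x a}

/-- `e(x)`, the number of atoms. -/
noncomputable def kunzE (m : ℕ) (x : ZMod m → ℝ) : ℕ := (KunzAtoms m x).ncard

/-- The normal vector `e_i + e_j - e_{i+j}` of a supporting hyperplane of the Kunz cone. -/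
def hypVec (m : ℕ) (i j : ZMod m) : ZMod m → ℚ :=
  Pi.single i 1 + Pi.single j 1 - Pi.single (i + j) 1

/-- `d(x)`, the dimension of the face of `C_m` whose relative interior contains `x`. -/
noncomputable def kunzD (m : ℕ) (x : ZMod m → ℝ) : ℕ :=
  (m - 1) - Module.finrank ℚ (Submodule.span ℚ
    {v : ZMod m → ℚ | ∃ p ∈ EqualitySet m x, v = hypVec m p.1 p.2})

/-- `z : ℕ^{A(x)}` is a factorization of the nonzero residue `a`. -/
def IsKunzFactorization (m : ℕ) [NeZero m] (x : ZMod m → ℝ) (a : ZMod m)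
    (z : ZMod m → ℕ) : Prop :=
  (∀ c, z c ≠ 0 → c ∈ KunzAtoms m x) ∧
  (∑ c : ZMod m, (z c : ZMod m) * c) = a ∧
  (∑ c : ZMod m, (z c : ℝ) * x c) = x a

/-- `Z(a)`, the set of factorizations of `a`. -/
def KunzFactorizations (m : ℕ) [NeZero m] (x : ZMod m → ℝ) (a : ZMod m) :
    Set (ZMod m → ℕ) :=
  {z | IsKunzFactorization m x a z}

/-- The presentation lattice `L(x)`: the subgroup of `ℤ^{A(x)}` generated by all differences
of pairs of factorizations of a common nonzero residue. -/
def PresentationLattice (m : ℕ) [NeZero m] (x : ZMod m → ℝ) :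
    AddSubgroup (ZMod m → ℤ) :=
  AddSubgroup.closure {v | ∃ a : ZMod m, a ≠ 0 ∧ ∃ z z',
    z ∈ KunzFactorizations m x a ∧ z' ∈ KunzFactorizations m x a ∧
    v = fun c => (z c : ℤ) - (z' c : ℤ)}

/-- Factorizations add up along the relations in the equality set. -/
lemma IsKunzFactorization.add {m : ℕ} [NeZero m] {x : ZMod m → ℝ} {i j : ZMod m}
    {z z' : ZMod m → ℕ} (hz : IsKunzFactorization m x i z)
    (hz' : IsKunzFactorization m x j z') (h : x i + x j = x (i + j)) :
    IsKunzFactorization m x (i + j) (z + z') := by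
  obtain ⟨hA, hs, hv⟩ := hz
  obtain ⟨hA', hs', hv'⟩ := hz'
  refine ⟨fun c hc => ?_, ?_, ?_⟩
  · by_cases h0 : z c = 0
    · exact hA' c fun h1 => hc (by simp [h0, h1])
    · exact hA c h0
  · simp only [Pi.add_apply, Nat.cast_add, add_mul, Finset.sum_add_distrib, hs, hs']
  · simp only [Pi.add_apply, Nat.cast_add, add_mul, Finset.sum_add_distrib, hv, hv', h]

/-- An atom factors as itself. -/
lemma isKunzFactorization_single {m : ℕ} [NeZero m] {x : ZMod m → ℝ} {a : ZMod m}
    (ha : a ∈ KunzAtoms m x) : IsKunzFactorization m x a (Pi.single a 1) := by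
  refine ⟨fun c hc => ?_, ?_, ?_⟩
  · by_cases h : c = a
    · exact h ▸ ha
    · simp [h] at hc
  · simp [Pi.single_apply]
  · simp [Pi.single_apply]

/-- If `x` has positive coordinates, every nonzero residue has a factorization. -/
lemma exists_isKunzFactorization {m : ℕ} [NeZero m] {x : ZMod m → ℝ}
    (hpos : ∀ i : ZMod m, i ≠ 0 → 0 < x i) (a : ZMod m) (ha : a ≠ 0) :
    ∃ z, IsKunzFactorization m x a z := by
  have wf : WellFounded fun i j : ZMod m => x i < x j :=
    @Finite.wellFounded_of_trans_of_irrefl _ _ _ ⟨fun _ _ _ => lt_trans⟩ ⟨fun _ => lt_irrefl _⟩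
  induction a using wf.induction with
  | _ a ih =>
    by_cases hat : a ∈ KunzAtoms m x
    · exact ⟨_, isKunzFactorization_single hat⟩
    · simp only [KunzAtoms, Set.mem_ofPred_eq, not_and, not_forall, not_not] at hat
      obtain ⟨i, j, hi, hj, rfl, h⟩ := hat ha
      obtain ⟨z, hz⟩ := ih i (by linarith [hpos j hj]) hi
      obtain ⟨z', hz'⟩ := ih j (by linarith [hpos i hi]) hj
      exact ⟨_, hz.add hz' h⟩

/-- A homomorphism from a finite free `ℤ`-module to `ZMod m` lifts to homomorphisms to `ℤ`
that approximate arbitrarily large multiples of a given real-valued homomorphism, and hence are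
eventually positive wherever the latter is. -/
lemma exists_lift_eventually_pos {m : ℕ} [NeZero m] {Q : Type*} [AddCommGroup Q]
    [Module.Free ℤ Q] [Module.Finite ℤ Q] (φ : Q →+ ZMod m) (ξ : Q →+ ℝ) :
    ∃ w : ℕ → Q →+ ℤ, (∀ t q, (w t q : ZMod m) = φ q) ∧
      ∀ q, 0 < ξ q → ∀ᶠ t in Filter.atTop, 0 < w t q := by
  let b := Module.Free.chooseBasis ℤ Q
  let w : ℕ → Q →ₗ[ℤ] ℤ := fun t =>
    b.constr ℤ fun i => ((φ (b i)).val : ℤ) + m * ⌊(t : ℝ) * ξ (b i)⌋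
  have hw : ∀ t q, w t q =
      ∑ i, b.repr q i * (((φ (b i)).val : ℤ) + m * ⌊(t : ℝ) * ξ (b i)⌋) := fun t q => by
    simp only [w, Module.Basis.constr_apply_fintype, Module.Basis.equivFun_apply, smul_eq_mul]
  refine ⟨fun t => (w t).toAddMonoidHom, fun t q => ?_, fun q hq => ?_⟩
  · change ((w t q : ℤ) : ZMod m) = φ q
    conv_rhs => rw [← b.sum_repr q]
    rw [map_sum, hw]
    simp [map_zsmul]
  · have hξ : ξ q = ∑ i, (b.repr q i : ℝ) * ξ (b i) := by
      conv_lhs => rw [← b.sum_repr q, map_sum]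
      simp [map_zsmul]
    have hm : (0 : ℝ) < m := by exact_mod_cast Nat.pos_of_ne_zero (NeZero.ne m)
    have key : ∀ t : ℕ, (m : ℝ) * (t * ξ q) - ∑ i, |(b.repr q i : ℝ)| * m ≤ (w t q : ℝ) := by
      intro t
      rw [hw, hξ, Finset.mul_sum, Finset.mul_sum, ← Finset.sum_sub_distrib]
      push_cast
      refine Finset.sum_le_sum fun i _ => ?_
      have h1 := Int.floor_le ((t : ℝ) * ξ (b i))
      have h2 := Int.lt_floor_add_one ((t : ℝ) * ξ (b i))
      have h3 : ((φ (b i)).val : ℝ) ≤ m := by exact_mod_cast (ZMod.val_lt _).le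
      have h4 : (0 : ℝ) ≤ (φ (b i)).val := Nat.cast_nonneg _
      set f : ℝ := (⌊(t : ℝ) * ξ (b i)⌋ : ℝ)
      have h5 : |m * (t * ξ (b i) - f) - ((φ (b i)).val : ℝ)| ≤ m := by
        rw [abs_le]
        constructor <;> nlinarith
      have h6 := le_abs_self ((b.repr q i : ℝ) * (m * (t * ξ (b i) - f) - ((φ (b i)).val : ℝ)))
      rw [abs_mul] at h6
      have h7 := mul_le_mul_of_nonneg_left h5 (abs_nonneg (b.repr q i : ℝ))
      linarith
    have ht : Filter.Tendsto (fun t : ℕ => (m : ℝ) * (t * ξ q)) Filter.atTop Filter.atTop :=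
      (tendsto_natCast_atTop_atTop.atTop_mul_const hq).const_mul_atTop hm
    filter_upwards [ht.eventually_gt_atTop (∑ i, |(b.repr q i : ℝ)| * m)] with t h
    have : (0 : ℝ) < (w t q : ℝ) := by linarith [key t]
    exact_mod_cast this

/-- If the presentation lattice `L(x)` is saturated (it equals the set of integer vectors
in its ℚ-linear span), then the face of `C_m` containing `x` is Apéry. -/
theorem apery_of_saturated_presentation_lattice (m : ℕ) (hm : 2 ≤ m) [NeZero m]
    (x : ZMod m → ℝ) (hx : x ∈ KunzCone m) (hpos : ∀ i : ZMod m, i ≠ 0 → 0 < x i)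
    (hsat : ∀ v : ZMod m → ℤ,
      (fun c => (v c : ℚ)) ∈ Submodule.span ℚ
        ((fun w : ZMod m → ℤ => fun c => (w c : ℚ)) ''
          (PresentationLattice m x : Set (ZMod m → ℤ))) →
      v ∈ PresentationLattice m x) :
    ∃ y, IsAperyPoint m y ∧ EqualitySet m y = EqualitySet m x := by
  classical
  let L := PresentationLattice m x
  let φ₀ : (ZMod m → ℤ) →+ ZMod m :=
    { toFun := fun v => ∑ c, (v c : ZMod m) * c
      map_zero' := by simp
      map_add' := fun u v => by simp [add_mul, Finset.sum_add_distrib] }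
  let ξ₀ : (ZMod m → ℤ) →+ ℝ :=
    { toFun := fun v => ∑ c, (v c : ℝ) * x c
      map_zero' := by simp
      map_add' := fun u v => by simp [add_mul, Finset.sum_add_distrib] }
  have hφL : L ≤ φ₀.ker := by
    refine (AddSubgroup.closure_le _).2 ?_
    rintro _ ⟨a, -, z, z', hz, hz', rfl⟩
    simp [φ₀, AddMonoidHom.mem_ker, sub_mul, Finset.sum_sub_distrib, hz.2.1, hz'.2.1]
  have hξL : L ≤ ξ₀.ker := by
    refine (AddSubgroup.closure_le _).2 ?_
    rintro _ ⟨a, -, z, z', hz, hz', rfl⟩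
    simp [ξ₀, AddMonoidHom.mem_ker, sub_mul, Finset.sum_sub_distrib, hz.2.2, hz'.2.2]
  have hfin : Module.Finite ℤ ((ZMod m → ℤ) ⧸ L) :=
    Module.Finite.of_surjective (QuotientAddGroup.mk' L).toIntLinearMap
      (QuotientAddGroup.mk'_surjective L)
  have htf : Module.IsTorsionFree ℤ ((ZMod m → ℤ) ⧸ L) := by
    refine Module.isTorsionFree_iff_smul_eq_zero.2 fun n q h => ?_
    obtain ⟨v, rfl⟩ := QuotientAddGroup.mk_surjective q
    refine or_iff_not_imp_left.2 fun hn => (QuotientAddGroup.eq_zero_iff v).2 (hsat v ?_)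
    have hv : n • v ∈ L := (QuotientAddGroup.eq_zero_iff _).1 h
    have hs := Submodule.smul_mem _ (n : ℚ)⁻¹ (Submodule.subset_span (R := ℚ)
      (Set.mem_image_of_mem (fun w : ZMod m → ℤ => fun c => (w c : ℚ)) hv))
    convert hs using 1
    ext c
    have : (n : ℚ) ≠ 0 := by exact_mod_cast hn
    simp [this]
  have hfree : Module.Free ℤ ((ZMod m → ℤ) ⧸ L) := inferInstance
  obtain ⟨w, hwφ, hwpos⟩ := exists_lift_eventually_pos
    (QuotientAddGroup.lift L φ₀ hφL) (QuotientAddGroup.lift L ξ₀ hξL)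
  choose! f hf using exists_isKunzFactorization hpos
  let mk : (ZMod m → ℕ) → (ZMod m → ℤ) ⧸ L := fun z => ((fun c => (z c : ℤ) : ZMod m → ℤ) : _ ⧸ L)
  have mk_add : ∀ z z', mk (z + z') = mk z + mk z' := fun z z' => by
    simp only [mk, ← QuotientAddGroup.mk_add]
    congr 1
  have mk_eq : ∀ a ≠ 0, ∀ z z', IsKunzFactorization m x a z → IsKunzFactorization m x a z' →
      mk z = mk z' := fun a ha z z' hz hz' => by
    rw [← sub_eq_zero, ← QuotientAddGroup.mk_sub]
    exact (QuotientAddGroup.eq_zero_iff _).2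
      (AddSubgroup.subset_closure ⟨a, ha, z, z', hz, hz', rfl⟩)
  have hφ : ∀ a ≠ 0, QuotientAddGroup.lift L φ₀ hφL (mk (f a)) = a := fun a ha => by
    simpa [mk, φ₀] using (hf a ha).2.1
  have hξ : ∀ a ≠ 0, QuotientAddGroup.lift L ξ₀ hξL (mk (f a)) = x a := fun a ha => by
    simpa [mk, ξ₀] using (hf a ha).2.2
  have hev : ∀ᶠ t in Filter.atTop, ∀ i j : ZMod m, i ≠ 0 → j ≠ 0 → i + j ≠ 0 →
      x (i + j) < x i + x j → w t (mk (f (i + j))) < w t (mk (f i)) + w t (mk (f j)) := by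
    simp only [Filter.eventually_all]
    intro i j hi hj hij h
    filter_upwards [hwpos (mk (f i) + mk (f j) - mk (f (i + j))) (by
      rw [map_sub, map_add, hξ i hi, hξ j hj, hξ _ hij]
      linarith)] with t ht
    rw [map_sub, map_add] at ht
    linarith
  obtain ⟨t, ht⟩ := hev.exists
  have heq : ∀ i j : ZMod m, i ≠ 0 → j ≠ 0 → i + j ≠ 0 → x i + x j = x (i + j) →
      w t (mk (f i)) + w t (mk (f j)) = w t (mk (f (i + j))) := fun i j hi hj hij h => by
    rw [← map_add, ← mk_add, mk_eq _ hij _ _ ((hf i hi).add (hf j hj) h) (hf _ hij)]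
  refine ⟨fun a => (w t (mk (f a)) : ℝ), ⟨fun i j hi hj hij => ?_, fun i hi => ?_⟩, ?_⟩
  · rcases (hx i j hi hj hij).lt_or_eq with h | h
    · beta_reduce
      exact_mod_cast (ht i j hi hj hij h).le
    · beta_reduce
      exact_mod_cast (heq i j hi hj hij h.symm).ge
  · exact ⟨_, rfl, (hwφ t _).trans (hφ i hi)⟩
  · ext ⟨i, j⟩
    refine and_congr_right fun hi => and_congr_right fun hj => and_congr_right fun hij => ?_
    refine ⟨fun h => ?_, fun h => by beta_reduce; exact_mod_cast heq i j hi hj hij h⟩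
    beta_reduce at h
    by_contra hne
    have hlt := ht i j hi hj hij (lt_of_le_of_ne (hx i j hi hj hij) (Ne.symm hne))
    exact hlt.ne' (by exact_mod_cast h)
end

section
/- Fix an integer m ≥ 2 and a point x ∈ C_m all of whose coordinates are positive. If there exist an integer n ≥ 2 and distinct atoms a, b ∈ A(x) such that n·(e_a − e_b) ∈ L(x) (where e_a, e_b are standard basis vectors of ℤ^{A(x)}), then there is no Apéry point y of C_m with E(y) = E(x). -/
open scoped BigOperators

/-- The weight of a multiset of nonzero residues is at least the coordinate at its sum. -/
theorem KunzCone.le_sum_map {m : ℕ} {x : ZMod m → ℝ} (hx : x ∈ KunzCone m)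
    (hpos : ∀ i : ZMod m, i ≠ 0 → 0 < x i) (s : Multiset (ZMod m))
    (hs : ∀ c ∈ s, c ≠ 0) (hsum : s.sum ≠ 0) : x s.sum ≤ (s.map x).sum := by
  induction s using Multiset.induction_on with
  | empty => simp at hsum
  | cons c s ih =>
    have hc : c ≠ 0 := hs c (Multiset.mem_cons_self c s)
    have hs' : ∀ d ∈ s, d ≠ 0 := fun d hd => hs d (Multiset.mem_cons_of_mem hd)
    rw [Multiset.sum_cons] at hsum ⊢
    rw [Multiset.map_cons, Multiset.sum_cons]
    by_cases h0 : s.sum = 0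
    · have : 0 ≤ (s.map x).sum := Multiset.sum_nonneg fun r hr => by
        obtain ⟨d, hd, rfl⟩ := Multiset.mem_map.1 hr
        exact (hpos d (hs' d hd)).le
      rw [h0, add_zero]
      linarith
    · have := hx c s.sum hc h0 hsum
      have := ih hs' h0
      linarith

/-- A multiset of nonzero residues whose `x`-weight equals the `x`-coordinate at its sum has the
same property for every point with the same equality set as `x`. -/
theorem KunzCone.sum_map_eq_of_equalitySet_eq {m : ℕ} {x y : ZMod m → ℝ}
    (hx : x ∈ KunzCone m) (hpos : ∀ i : ZMod m, i ≠ 0 → 0 < x i)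
    (hE : EqualitySet m y = EqualitySet m x) (s : Multiset (ZMod m))
    (hs : ∀ c ∈ s, c ≠ 0) (hsum : s.sum ≠ 0) (heq : (s.map x).sum = x s.sum) :
    (s.map y).sum = y s.sum := by
  induction s using Multiset.induction_on with
  | empty => simp at hsum
  | cons c s ih =>
    have hc : c ≠ 0 := hs c (Multiset.mem_cons_self c s)
    have hs' : ∀ d ∈ s, d ≠ 0 := fun d hd => hs d (Multiset.mem_cons_of_mem hd)
    rw [Multiset.map_cons, Multiset.sum_cons, Multiset.sum_cons] at heq
    rw [Multiset.sum_cons] at hsum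
    rw [Multiset.map_cons, Multiset.sum_cons, Multiset.sum_cons]
    by_cases h0 : s.sum = 0
    · rw [h0, add_zero] at heq ⊢
      rcases s.empty_or_exists_mem with rfl | ⟨d, hd⟩
      · simp
      · have hle : x d ≤ (s.map x).sum :=
          Multiset.single_le_sum (fun r hr => by
            obtain ⟨e, he, rfl⟩ := Multiset.mem_map.1 hr
            exact (hpos e (hs' e he)).le) _ (Multiset.mem_map_of_mem x hd)
        have := hpos d (hs' d hd)
        linarith
    · have hcone := hx c s.sum hc h0 hsum
      have hle := KunzCone.le_sum_map hx hpos s hs' h0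
      have hmem : (c, s.sum) ∈ EqualitySet m y := by
        rw [hE]
        exact ⟨hc, h0, hsum, by dsimp only; linarith⟩
      rw [ih hs' h0 (by linarith)]
      exact hmem.2.2.2

/-- A factorization with respect to `x` is weight-preserving for every point with the same
equality set as `x`. -/
theorem IsKunzFactorization.sum_mul_eq {m : ℕ} [NeZero m] {x y : ZMod m → ℝ}
    (hx : x ∈ KunzCone m) (hpos : ∀ i : ZMod m, i ≠ 0 → 0 < x i)
    (hE : EqualitySet m y = EqualitySet m x) {a : ZMod m} (ha : a ≠ 0) {z : ZMod m → ℕ}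
    (hz : IsKunzFactorization m x a z) : ∑ c, (z c : ℝ) * y c = y a := by
  obtain ⟨hatoms, hres, hwt⟩ := hz
  let s : Multiset (ZMod m) := ∑ c, Multiset.replicate (z c) c
  have hmap (f : ZMod m → ℝ) : (s.map f).sum = ∑ c, (z c : ℝ) * f c := by
    rw [← Multiset.coe_mapAddMonoidHom, map_sum, Multiset.sum_sum]
    simp
  have hsum : s.sum = a := by
    rw [← hres]
    simp [s, Multiset.sum_sum]
  have hs : ∀ c ∈ s, c ≠ 0 := fun c hc => by
    obtain ⟨d, -, hd⟩ := Multiset.mem_sum.1 hc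
    obtain ⟨hzd, rfl⟩ := Multiset.mem_replicate.1 hd
    exact (hatoms c hzd).1
  rw [← hmap, ← hsum]
  exact KunzCone.sum_map_eq_of_equalitySet_eq hx hpos hE s hs (hsum ▸ ha)
    (by rw [hmap, hwt, hsum])

/-- The presentation lattice of `x` is orthogonal to every point with the same equality set
as `x`. -/
theorem sum_mul_eq_zero_of_mem_presentationLattice {m : ℕ} [NeZero m] {x y : ZMod m → ℝ}
    (hx : x ∈ KunzCone m) (hpos : ∀ i : ZMod m, i ≠ 0 → 0 < x i)
    (hE : EqualitySet m y = EqualitySet m x) {v : ZMod m → ℤ}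
    (hv : v ∈ PresentationLattice m x) : ∑ c, (v c : ℝ) * y c = 0 := by
  induction hv using AddSubgroup.closure_induction with
  | mem v hv =>
    obtain ⟨a, ha, z, z', hz, hz', rfl⟩ := hv
    have h := IsKunzFactorization.sum_mul_eq hx hpos hE ha hz
    have h' := IsKunzFactorization.sum_mul_eq hx hpos hE ha hz'
    simp [sub_mul, Finset.sum_sub_distrib, h, h']
  | zero => simp
  | add v w _ _ hv hw => simp [add_mul, Finset.sum_add_distrib, hv, hw]
  | neg v _ hv => simp [hv]

/-- If `n (e_a - e_b) ∈ L(x)` for some `n ≥ 2` and distinct atoms `a ≠ b`, then the face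
of `C_m` containing `x` is not Apéry. -/
theorem not_apery_of_multiple_of_basis_difference (m : ℕ) (hm : 2 ≤ m) [NeZero m]
    (x : ZMod m → ℝ) (hx : x ∈ KunzCone m) (hpos : ∀ i : ZMod m, i ≠ 0 → 0 < x i)
    (n : ℕ) (hn : 2 ≤ n) (a b : ZMod m)
    (ha : a ∈ KunzAtoms m x) (hb : b ∈ KunzAtoms m x) (hab : a ≠ b)
    (hmem : (n : ℤ) • (Pi.single a (1 : ℤ) - Pi.single b 1) ∈ PresentationLattice m x) :
    ¬ ∃ y, IsAperyPoint m y ∧ EqualitySet m y = EqualitySet m x := by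
  rintro ⟨y, ⟨-, hy⟩, hE⟩
  have h := sum_mul_eq_zero_of_mem_presentationLattice hx hpos hE hmem
  have hn0 : (n : ℝ) ≠ 0 := by positivity
  have hyab : y a = y b := by
    have h' : (n : ℝ) * (y a - y b) = 0 := by
      rw [← h]
      simp [Pi.single_apply, mul_sub, sub_mul, Finset.sum_sub_distrib]
    exact sub_eq_zero.1 ((mul_eq_zero.1 h').resolve_left hn0)
  obtain ⟨p, hp, rfl⟩ := hy a ha.1
  obtain ⟨q, hq, rfl⟩ := hy b hb.1
  rw [hp, hq, Int.cast_inj] at hyab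
  exact hab (congrArg _ hyab)
end

section
/- Fix an integer m ≥ 7 and a point x ∈ C_m all of whose coordinates are positive. If e(x) = m − 2, then ⌊(m−1)/2⌋ ≤ d(x) ≤ m − 2. -/
open scoped BigOperators

lemma hypVec_comm (m : ℕ) (i j : ZMod m) : hypVec m i j = hypVec m j i := by
  simp only [hypVec, add_comm]

lemma hypVec_ne_zero (m : ℕ) {i j : ZMod m} (hi : i ≠ 0) (hj : j ≠ 0) : hypVec m i j ≠ 0 := by
  intro h
  have h' := congrFun h (i + j)
  simp [hypVec, hi, hj] at h'

/-- The hyperplane normals of pairs with a fixed sum are indexed by at most `m / 2` residues. -/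
lemma hypVec_mem_image (m : ℕ) [NeZero m] {i j : ZMod m} (hi : i ≠ 0) (hj : j ≠ 0) :
    hypVec m i j ∈
      (Finset.Icc 1 ((i + j).val / 2) ∪
        Finset.Icc ((i + j).val + 1) ((m + (i + j).val) / 2)).image
          fun t : ℕ => hypVec m t (i + j - t) := by
  have hvi : 0 < i.val := ZMod.val_pos.2 hi
  have hvj : 0 < j.val := ZMod.val_pos.2 hj
  have hli := ZMod.val_lt i
  have hlj := ZMod.val_lt j
  have hsum : (i + j).val = i.val + j.val ∨ (i + j).val + m = i.val + j.val := by
    rcases lt_or_ge (i.val + j.val) m with h | h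
    · exact Or.inl (ZMod.val_add_of_lt h)
    · exact Or.inr (ZMod.val_add_val_of_le h).symm
  simp only [Finset.mem_image, Finset.mem_union, Finset.mem_Icc]
  rcases le_total i.val j.val with h | h
  · refine ⟨i.val, by omega, ?_⟩
    simp
  · refine ⟨j.val, by omega, ?_⟩
    simp [hypVec_comm m i j]

/-- A point with `e(x) = m - 2` has exactly one nonzero residue that is not an atom. -/
lemma exists_unique_nonatom (m : ℕ) (hm : 2 ≤ m) [NeZero m] (x : ZMod m → ℝ)
    (he : kunzE m x = m - 2) :
    ∃ p : ZMod m, p ≠ 0 ∧ p ∉ KunzAtoms m x ∧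
      ∀ a : ZMod m, a ≠ 0 → a ∉ KunzAtoms m x → a = p := by
  have h0 : (0 : ZMod m) ∉ KunzAtoms m x := fun h => h.1 rfl
  have h1 : (insert 0 (KunzAtoms m x)).ncard = m - 2 + 1 := by
    rw [Set.ncard_insert_of_notMem h0 (Set.toFinite _)]
    exact congrArg (· + 1) he
  have h2 := Set.ncard_add_ncard_compl (insert 0 (KunzAtoms m x))
  rw [h1, Nat.card_zmod] at h2
  obtain ⟨p, hp⟩ := Set.ncard_eq_one.1 (show (insert 0 (KunzAtoms m x))ᶜ.ncard = 1 by omega)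
  have key : ∀ a, a ∈ (insert 0 (KunzAtoms m x))ᶜ ↔ a = p := fun a => by rw [hp]; rfl
  simp only [Set.mem_compl_iff, Set.mem_insert_iff, not_or] at key
  exact ⟨p, ((key p).2 rfl).1, ((key p).2 rfl).2, fun a ha ha' => (key a).1 ⟨ha, ha'⟩⟩

/-- For `m ≥ 7`: if `e(x) = m - 2` then `⌊(m-1)/2⌋ ≤ d(x) ≤ m - 2`. -/
theorem dim_bounds_of_embdim_eq_m_sub_two (m : ℕ) (hm : 7 ≤ m) [NeZero m]
    (x : ZMod m → ℝ) (hx : x ∈ KunzCone m) (hpos : ∀ i : ZMod m, i ≠ 0 → 0 < x i)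
    (he : kunzE m x = m - 2) :
    (m - 1) / 2 ≤ kunzD m x ∧ kunzD m x ≤ m - 2 := by
  obtain ⟨p, hp0, hpA, huniq⟩ := exists_unique_nonatom m (by omega) x he
  set V := Submodule.span ℚ
    {v : ZMod m → ℚ | ∃ p ∈ EqualitySet m x, v = hypVec m p.1 p.2} with hV
  have hlower : 1 ≤ Module.finrank ℚ V := by
    obtain ⟨i, j, hi, hj, hij, hxij⟩ :
        ∃ i j : ZMod m, i ≠ 0 ∧ j ≠ 0 ∧ i + j = p ∧ x i + x j = x p := by
      by_contra! h
      exact hpA ⟨hp0, fun i j hi hj hij => h i j hi hj hij⟩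
    subst hij
    have hmem : hypVec m i j ∈ V := Submodule.subset_span ⟨(i, j), ⟨hi, hj, hp0, hxij⟩, rfl⟩
    rw [Submodule.one_le_finrank_iff]
    exact (Submodule.ne_bot_iff V).2 ⟨_, hmem, hypVec_ne_zero m hi hj⟩
  have hupper : Module.finrank ℚ V ≤ m / 2 := by
    set T := Finset.Icc 1 (p.val / 2) ∪ Finset.Icc (p.val + 1) ((m + p.val) / 2) with hT
    set I := T.image fun t : ℕ => hypVec m t (p - t) with hI
    have hle : V ≤ Submodule.span ℚ (I : Set (ZMod m → ℚ)) := by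
      refine Submodule.span_mono ?_
      rintro _ ⟨⟨i, j⟩, ⟨hi, hj, hij, hxij⟩, rfl⟩
      obtain rfl : i + j = p := huniq _ hij fun h => h.2 i j hi hj rfl hxij
      exact hypVec_mem_image m hi hj
    have hcard : T.card ≤ m / 2 := by
      refine (Finset.card_union_le _ _).trans ?_
      simp only [Nat.card_Icc]
      have := ZMod.val_lt p
      omega
    calc Module.finrank ℚ V
        ≤ Module.finrank ℚ (Submodule.span ℚ (I : Set (ZMod m → ℚ))) :=
          Submodule.finrank_mono hle
      _ ≤ I.card := finrank_span_finset_le_card I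
      _ ≤ T.card := Finset.card_image_le
      _ ≤ m / 2 := hcard
  change (m - 1) / 2 ≤ m - 1 - Module.finrank ℚ V ∧ m - 1 - Module.finrank ℚ V ≤ m - 2
  omega
end
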